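/- Let N be even, let V be a Breuer–Hall unitary on ℂ^N, and let ρ be a positive semidefinite matrix on ℂ² ⊗ ℂ^N. Let α, β, γ, δ be reals, each ≥ -1, and suppose there exist reals a, b with 0 ≤ a ≤ 1, 0 ≤ b ≤ 1, a + b ≤ 1 such that α ≥ β/2 - a, β ≥ α/2 - a, γ ≥ δ/2 - b, and δ ≥ γ/2 - b. Then Tr(ρ)·𝟙_{2N} + α·ρ + β·ρ̃_A + γ·ρ̃_B + δ·ρ̃ is separable. -/

import Mathlib

open Matrix Kronecker
open scoped ComplexOrder

noncomputable section

/-- A Hermitian matrix on ℂ^M ⊗ ℂ^N is separable if it is a finite sum of Kronecker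
products of positive semidefinite matrices. -/
def IsSeparableMat {M N : ℕ} (σ : Matrix (Fin M × Fin N) (Fin M × Fin N) ℂ) : Prop :=
  ∃ (k : ℕ) (A : Fin k → Matrix (Fin M) (Fin M) ℂ) (B : Fin k → Matrix (Fin N) (Fin N) ℂ),
    (∀ i, (A i).PosSemidef) ∧ (∀ i, (B i).PosSemidef) ∧ σ = ∑ i, A i ⊗ₖ B i

/-- Partial transpose on the first (Alice) factor. -/
def ptA {M N : ℕ} (ρ : Matrix (Fin M × Fin N) (Fin M × Fin N) ℂ) :
    Matrix (Fin M × Fin N) (Fin M × Fin N) ℂ :=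
  fun p q => ρ (q.1, p.2) (p.1, q.2)

/-- Partial transpose on the second (Bob) factor. -/
def ptB {M N : ℕ} (ρ : Matrix (Fin M × Fin N) (Fin M × Fin N) ℂ) :
    Matrix (Fin M × Fin N) (Fin M × Fin N) ℂ :=
  fun p q => ρ (p.1, q.2) (q.1, p.2)

/-- The second Pauli matrix σ₂. -/
def pauli2 : Matrix (Fin 2) (Fin 2) ℂ := !![0, -Complex.I; Complex.I, 0]

/-- ρ̃_A = (σ₂ ⊗ 𝟙_N) ρ^{T_A} (σ₂ ⊗ 𝟙_N). -/
def tildeA {N : ℕ} (ρ : Matrix (Fin 2 × Fin N) (Fin 2 × Fin N) ℂ) :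
    Matrix (Fin 2 × Fin N) (Fin 2 × Fin N) ℂ :=
  (pauli2 ⊗ₖ (1 : Matrix (Fin N) (Fin N) ℂ)) * ptA ρ *
    (pauli2 ⊗ₖ (1 : Matrix (Fin N) (Fin N) ℂ))

end

section Helpers

variable {M N : ℕ}

theorem IsSeparableMat.kronecker {A : Matrix (Fin M) (Fin M) ℂ} {B : Matrix (Fin N) (Fin N) ℂ}
    (hA : A.PosSemidef) (hB : B.PosSemidef) : IsSeparableMat (A ⊗ₖ B) :=
  ⟨1, fun _ => A, fun _ => B, fun _ => hA, fun _ => hB, by simp⟩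

theorem IsSeparableMat.zero :
    IsSeparableMat (0 : Matrix (Fin M × Fin N) (Fin M × Fin N) ℂ) :=
  ⟨0, 0, 0, fun i => i.elim0, fun i => i.elim0, by simp⟩

theorem IsSeparableMat.add {σ τ : Matrix (Fin M × Fin N) (Fin M × Fin N) ℂ}
    (hσ : IsSeparableMat σ) (hτ : IsSeparableMat τ) : IsSeparableMat (σ + τ) := by
  obtain ⟨k, A, B, hA, hB, rfl⟩ := hσ
  obtain ⟨l, C, D, hC, hD, rfl⟩ := hτ
  refine ⟨k + l, Fin.append A C, Fin.append B D, ?_, ?_, ?_⟩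
  · intro i
    refine Fin.addCases (fun j => ?_) (fun j => ?_) i <;> simp [hA, hC]
  · intro i
    refine Fin.addCases (fun j => ?_) (fun j => ?_) i <;> simp [hB, hD]
  · simp [Fin.sum_univ_add]

theorem IsSeparableMat.sum {ι : Type*} (s : Finset ι)
    {σ : ι → Matrix (Fin M × Fin N) (Fin M × Fin N) ℂ} (h : ∀ i ∈ s, IsSeparableMat (σ i)) :
    IsSeparableMat (∑ i ∈ s, σ i) := by
  classical
  induction s using Finset.induction_on with
  | empty => simpa using IsSeparableMat.zero
  | insert a s ha ih =>
    rw [Finset.sum_insert ha]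
    exact (h a (by simp)).add (ih fun i hi => h i (by simp [hi]))

/-- An additive map sending products of positive semidefinite matrices to separable matrices
preserves separability. -/
theorem IsSeparableMat.map {M' N' : ℕ} {σ : Matrix (Fin M × Fin N) (Fin M × Fin N) ℂ}
    (hσ : IsSeparableMat σ)
    (f : Matrix (Fin M × Fin N) (Fin M × Fin N) ℂ →ₗ[ℂ]
      Matrix (Fin M' × Fin N') (Fin M' × Fin N') ℂ)
    (hf : ∀ A B, A.PosSemidef → B.PosSemidef → IsSeparableMat (f (A ⊗ₖ B))) :
    IsSeparableMat (f σ) := by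
  obtain ⟨k, A, B, hA, hB, rfl⟩ := hσ
  rw [map_sum]
  exact IsSeparableMat.sum _ fun i _ => hf _ _ (hA i) (hB i)

theorem posSemidef_ofReal_smul {n : Type*} {A : Matrix n n ℂ} (hA : A.PosSemidef)
    {c : ℝ} (hc : 0 ≤ c) : ((c : ℂ) • A).PosSemidef :=
  hA.smul (Complex.zero_le_real.mpr hc)

theorem IsSeparableMat.smul {σ : Matrix (Fin M × Fin N) (Fin M × Fin N) ℂ}
    (hσ : IsSeparableMat σ) {c : ℝ} (hc : 0 ≤ c) : IsSeparableMat ((c : ℂ) • σ) :=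
  hσ.map ((c : ℂ) • LinearMap.id) fun A B hA hB => by
    simpa [← smul_kronecker] using IsSeparableMat.kronecker (posSemidef_ofReal_smul hA hc) hB

/-- Conjugation by a local operator on the first factor. -/
def conjA (U : Matrix (Fin M) (Fin M) ℂ) :
    Matrix (Fin M × Fin N) (Fin M × Fin N) ℂ →ₗ[ℂ] Matrix (Fin M × Fin N) (Fin M × Fin N) ℂ where
  toFun ρ := (U ⊗ₖ (1 : Matrix (Fin N) (Fin N) ℂ)) * ρ * (U ⊗ₖ (1 : Matrix (Fin N) (Fin N) ℂ))ᴴ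
  map_add' := by intros; simp [mul_add, add_mul]
  map_smul' := by intros; simp

/-- The map `ρ ↦ ρ̃_A`, as a linear map. -/
def flipA : Matrix (Fin 2 × Fin N) (Fin 2 × Fin N) ℂ →ₗ[ℂ]
    Matrix (Fin 2 × Fin N) (Fin 2 × Fin N) ℂ where
  toFun := tildeA
  map_add' ρ σ := by
    have : ptA (ρ + σ) = ptA ρ + ptA σ := rfl
    simp [tildeA, this, mul_add, add_mul]
  map_smul' c ρ := by
    have : ptA (c • ρ) = c • ptA ρ := rfl
    simp [tildeA, this]

/-- The map `ρ ↦ ρ̃_B`, as a linear map. -/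
def flipB (V : Matrix (Fin N) (Fin N) ℂ) : Matrix (Fin M × Fin N) (Fin M × Fin N) ℂ →ₗ[ℂ]
    Matrix (Fin M × Fin N) (Fin M × Fin N) ℂ where
  toFun ρ := ((1 : Matrix (Fin M) (Fin M) ℂ) ⊗ₖ V) * ptB ρ * ((1 : Matrix (Fin M) (Fin M) ℂ) ⊗ₖ V)ᴴ
  map_add' ρ σ := by
    have : ptB (ρ + σ) = ptB ρ + ptB σ := rfl
    simp [this, mul_add, add_mul]
  map_smul' c ρ := by
    have : ptB (c • ρ) = c • ptB ρ := rfl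
    simp [this]

theorem flipA_apply (ρ : Matrix (Fin 2 × Fin N) (Fin 2 × Fin N) ℂ) : flipA ρ = tildeA ρ := rfl

theorem flipB_apply (V : Matrix (Fin N) (Fin N) ℂ)
    (ρ : Matrix (Fin M × Fin N) (Fin M × Fin N) ℂ) :
    flipB V ρ = ((1 : Matrix (Fin M) (Fin M) ℂ) ⊗ₖ V) * ptB ρ *
      ((1 : Matrix (Fin M) (Fin M) ℂ) ⊗ₖ V)ᴴ := rfl

theorem conjA_kronecker (U A : Matrix (Fin M) (Fin M) ℂ) (B : Matrix (Fin N) (Fin N) ℂ) :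
    conjA U (A ⊗ₖ B) = (U * A * Uᴴ) ⊗ₖ B := by
  simp [conjA, conjTranspose_kronecker, ← mul_kronecker_mul]

theorem flipA_kronecker (A : Matrix (Fin 2) (Fin 2) ℂ) (B : Matrix (Fin N) (Fin N) ℂ) :
    flipA (A ⊗ₖ B) = (pauli2 * Aᵀ * pauli2) ⊗ₖ B := by
  have : ptA (A ⊗ₖ B) = Aᵀ ⊗ₖ B := rfl
  simp [flipA_apply, tildeA, this, ← mul_kronecker_mul]

theorem flipB_kronecker (V : Matrix (Fin N) (Fin N) ℂ) (A : Matrix (Fin M) (Fin M) ℂ)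
    (B : Matrix (Fin N) (Fin N) ℂ) : flipB V (A ⊗ₖ B) = A ⊗ₖ (V * Bᵀ * Vᴴ) := by
  have : ptB (A ⊗ₖ B) = A ⊗ₖ Bᵀ := rfl
  simp [flipB_apply, this, conjTranspose_kronecker, ← mul_kronecker_mul]

theorem pauli2_conjTranspose : pauli2ᴴ = pauli2 := by
  ext i j
  fin_cases i <;> fin_cases j <;> simp [pauli2]

theorem pauli2_mul_self : pauli2 * pauli2 = 1 := by
  ext i j
  fin_cases i <;> fin_cases j <;> simp [pauli2]

theorem IsSeparableMat.conjA {σ : Matrix (Fin M × Fin N) (Fin M × Fin N) ℂ}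
    (hσ : IsSeparableMat σ) (U : Matrix (Fin M) (Fin M) ℂ) : IsSeparableMat (conjA U σ) :=
  hσ.map _ fun A B hA hB => by
    rw [conjA_kronecker]
    exact .kronecker (hA.mul_mul_conjTranspose_same U) hB

theorem IsSeparableMat.flipA {σ : Matrix (Fin 2 × Fin N) (Fin 2 × Fin N) ℂ}
    (hσ : IsSeparableMat σ) : IsSeparableMat (flipA σ) :=
  hσ.map _ fun A B hA hB => by
    rw [flipA_kronecker]
    refine .kronecker ?_ hB
    simpa only [pauli2_conjTranspose] using hA.transpose.mul_mul_conjTranspose_same pauli2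

theorem IsSeparableMat.flipB {σ : Matrix (Fin M × Fin N) (Fin M × Fin N) ℂ}
    (hσ : IsSeparableMat σ) (V : Matrix (Fin N) (Fin N) ℂ) : IsSeparableMat (flipB V σ) :=
  hσ.map _ fun A B hA hB => by
    rw [flipB_kronecker]
    exact .kronecker hA (hB.transpose.mul_mul_conjTranspose_same V)

theorem flipA_one :
    flipA (1 : Matrix (Fin 2 × Fin N) (Fin 2 × Fin N) ℂ) = 1 := by
  rw [← one_kronecker_one, flipA_kronecker]
  simp [pauli2_mul_self]

theorem flipB_one {V : Matrix (Fin N) (Fin N) ℂ} (hV : Vᴴ * V = 1) :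
    flipB V (1 : Matrix (Fin M × Fin N) (Fin M × Fin N) ℂ) = 1 := by
  rw [← one_kronecker_one, flipB_kronecker]
  simp [mul_eq_one_comm.mp hV]

theorem flipB_flipA (V : Matrix (Fin N) (Fin N) ℂ)
    (ρ : Matrix (Fin 2 × Fin N) (Fin 2 × Fin N) ℂ) :
    flipB V (flipA ρ) = (pauli2 ⊗ₖ V) * ρᵀ * (pauli2 ⊗ₖ V)ᴴ := by
  have h : ptB (tildeA ρ) = (pauli2 ⊗ₖ (1 : Matrix (Fin N) (Fin N) ℂ)) * ρᵀ *
      (pauli2 ⊗ₖ (1 : Matrix (Fin N) (Fin N) ℂ)) := by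
    ext ⟨i, a⟩ ⟨j, b⟩
    fin_cases i <;> fin_cases j <;>
      simp [ptB, tildeA, ptA, Matrix.mul_apply, pauli2, Fintype.sum_prod_type, one_apply]
  have h1 : pauli2 ⊗ₖ V = ((1 : Matrix (Fin 2) (Fin 2) ℂ) ⊗ₖ V) *
      (pauli2 ⊗ₖ (1 : Matrix (Fin N) (Fin N) ℂ)) := by
    simp [← mul_kronecker_mul]
  have h2 : (pauli2 ⊗ₖ (1 : Matrix (Fin N) (Fin N) ℂ))ᴴ =
      pauli2 ⊗ₖ (1 : Matrix (Fin N) (Fin N) ℂ) := by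
    simp [conjTranspose_kronecker, pauli2_conjTranspose]
  rw [h1, conjTranspose_mul, h2]
  simp only [flipB_apply, flipA_apply, h, Matrix.mul_assoc]

/-- The `2 × 2` block matrix with the given blocks, as a matrix on `ℂ² ⊗ ℂ^N`. -/
def blockMat (A B C D : Matrix (Fin N) (Fin N) ℂ) :
    Matrix (Fin 2 × Fin N) (Fin 2 × Fin N) ℂ :=
  of fun p q => !![A p.2 q.2, B p.2 q.2; C p.2 q.2, D p.2 q.2] p.1 q.1

theorem IsSeparableMat.blockMat_diag {A D : Matrix (Fin N) (Fin N) ℂ} (hA : A.PosSemidef)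
    (hD : D.PosSemidef) : IsSeparableMat (blockMat A 0 0 D) := by
  have h : blockMat A 0 0 D = vecMulVec ![1, 0] (star ![1, 0]) ⊗ₖ A +
      vecMulVec ![0, 1] (star ![0, 1]) ⊗ₖ D := by
    ext ⟨i, a⟩ ⟨j, b⟩
    simp only [Matrix.add_apply, kroneckerMap_apply, vecMulVec_apply, Pi.star_apply]
    fin_cases i <;> fin_cases j <;> simp [blockMat]
  rw [h]
  exact .add (.kronecker (posSemidef_vecMulVec_self_star _) hA)
    (.kronecker (posSemidef_vecMulVec_self_star _) hD)

/-- The average over fourth roots of unity `ω` of the product vectors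
`(1, q ω) ⊗ (u + ω̄ v)`. -/
theorem IsSeparableMat.blockMat_phase (q : ℝ) (u v : Fin N → ℂ) :
    IsSeparableMat (blockMat (vecMulVec u (star u) + vecMulVec v (star v))
      ((q : ℂ) • vecMulVec u (star v)) ((q : ℂ) • vecMulVec v (star u))
      ((q ^ 2 : ℂ) • (vecMulVec u (star u) + vecMulVec v (star v)))) := by
  have key (w : ℂ) : IsSeparableMat (((1 / 4 : ℝ) : ℂ) •
      (vecMulVec ![1, q * w] (star ![1, q * w]) ⊗ₖ
        vecMulVec (u + star w • v) (star (u + star w • v)))) :=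
    (IsSeparableMat.kronecker (posSemidef_vecMulVec_self_star _)
      (posSemidef_vecMulVec_self_star _)).smul (by norm_num)
  convert (((key 1).add (key (-1))).add (key Complex.I)).add (key (-Complex.I)) using 1
  ext ⟨i, a⟩ ⟨j, b⟩
  simp only [Matrix.add_apply, Matrix.smul_apply, kroneckerMap_apply, vecMulVec_apply,
    Pi.star_apply, Pi.add_apply, Pi.smul_apply]
  fin_cases i <;> fin_cases j <;> simp [blockMat, vecMulVec_apply] <;> ring_nf <;>
    simp [Complex.I_sq, Complex.I_pow_four] <;> ring

theorem posSemidef_sub_vecMulVec_sub_vecMulVec {n : ℝ} (hn : 0 ≤ n) {k l s t : ℝ} (hk : 0 ≤ k)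
    (hl : 0 ≤ l) {x y : Fin N → ℂ} (hxy : star x ⬝ᵥ y = 0) (hx : star x ⬝ᵥ x = (s : ℂ))
    (hy : star y ⬝ᵥ y = (t : ℂ)) (hs : k * s ≤ n) (ht : l * t ≤ n) :
    ((n : ℂ) • (1 : Matrix (Fin N) (Fin N) ℂ) - (k : ℂ) • vecMulVec x (star x)
      - (l : ℂ) • vecMulVec y (star y)).PosSemidef := by
  have hyx : star y ⬝ᵥ x = 0 := by
    rw [star_dotProduct, hxy, star_zero]
  rcases hn.eq_or_lt with rfl | hn
  · have aux {k s : ℝ} {x : Fin N → ℂ} (hk : 0 ≤ k) (hx : star x ⬝ᵥ x = (s : ℂ))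
        (hs : k * s ≤ 0) : (k : ℂ) • vecMulVec x (star x) = 0 := by
      have hs0 : 0 ≤ s := by
        have := dotProduct_star_self_nonneg x
        rw [hx] at this
        exact_mod_cast this
      rcases mul_eq_zero.mp (le_antisymm hs (mul_nonneg hk hs0)) with h | h
      · simp [h]
      · rw [h, Complex.ofReal_zero, dotProduct_star_self_eq_zero] at hx
        simp [hx]
    rw [aux hk hx hs, aux hl hy ht]
    simpa using PosSemidef.zero
  set T := (n : ℂ) • (1 : Matrix (Fin N) (Fin N) ℂ) - (k : ℂ) • vecMulVec x (star x)
      - (l : ℂ) • vecMulVec y (star y) with hT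
  have hTH : Tᴴ = T := by
    simp [hT, conjTranspose_sub, conjTranspose_smul, conjTranspose_vecMulVec]
  have hsq : T = ((n⁻¹ : ℝ) : ℂ) • (Tᴴ * T +
      ((k * (n - k * s) : ℝ) : ℂ) • vecMulVec x (star x) +
      ((l * (n - l * t) : ℝ) : ℂ) • vecMulVec y (star y)) := by
    have hn' : (n : ℂ) ≠ 0 := by exact_mod_cast hn.ne'
    have : (n : ℂ) • T = Tᴴ * T +
      ((k * (n - k * s) : ℝ) : ℂ) • vecMulVec x (star x) +
      ((l * (n - l * t) : ℝ) : ℂ) • vecMulVec y (star y) := by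
      rw [hTH, hT]
      simp only [sub_mul, mul_sub, smul_mul_assoc, mul_smul_comm, vecMulVec_mul_vecMulVec, hxy,
        hyx, hx, hy, one_mul, mul_one, zero_smul, vecMulVec_smul, smul_zero, vecMulVec_zero]
      push_cast
      module
    rw [← this, Complex.ofReal_inv, inv_smul_smul₀ hn']
  rw [hsq]
  exact posSemidef_ofReal_smul (((posSemidef_conjTranspose_mul_self T).add
    (posSemidef_ofReal_smul (posSemidef_vecMulVec_self_star x)
      (mul_nonneg hk (by linarith)))).add
    (posSemidef_ofReal_smul (posSemidef_vecMulVec_self_star y)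
      (mul_nonneg hl (by linarith)))) (by positivity)

theorem exists_star_dotProduct_self_eq_ofReal (x : Fin N → ℂ) :
    ∃ s : ℝ, 0 ≤ s ∧ star x ⬝ᵥ x = (s : ℂ) := by
  have := dotProduct_star_self_nonneg x
  obtain ⟨h1, h2⟩ := Complex.nonneg_iff.mp this
  exact ⟨_, h1, Complex.ext (by simp) (by simp [← h2])⟩

/-- The vector in `ℂ² ⊗ ℂ^N` with components `x` and `y`. -/
def pairVec (x y : Fin N → ℂ) : Fin 2 × Fin N → ℂ := fun p => ![x, y] p.1 p.2

theorem pairVec_eta (ψ : Fin 2 × Fin N → ℂ) :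
    pairVec (fun j => ψ (0, j)) (fun j => ψ (1, j)) = ψ := by
  ext ⟨i, a⟩
  fin_cases i <;> rfl

theorem vecMulVec_pairVec (x y : Fin N → ℂ) :
    vecMulVec (pairVec x y) (star (pairVec x y)) =
      blockMat (vecMulVec x (star x)) (vecMulVec x (star y)) (vecMulVec y (star x))
        (vecMulVec y (star y)) := by
  ext ⟨i, a⟩ ⟨j, b⟩
  fin_cases i <;> fin_cases j <;> simp [blockMat, vecMulVec_apply, pairVec]

theorem trace_vecMulVec_pairVec (x y : Fin N → ℂ) :
    (vecMulVec (pairVec x y) (star (pairVec x y))).trace =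
      star x ⬝ᵥ x + star y ⬝ᵥ y := by
  simp [trace_vecMulVec, dotProduct, Fintype.sum_prod_type, pairVec, mul_comm]

theorem flipA_blockMat (A B C D : Matrix (Fin N) (Fin N) ℂ) :
    flipA (blockMat A B C D) = blockMat D (-B) (-C) A := by
  ext ⟨i, a⟩ ⟨j, b⟩
  fin_cases i <;> fin_cases j <;>
    simp [flipA_apply, tildeA, ptA, blockMat, Matrix.mul_apply, pauli2, Fintype.sum_prod_type, one_apply,
      mul_comm, mul_left_comm, ← mul_assoc]

theorem isSeparableMat_trace_sub_of_orthogonal {x y : Fin N → ℂ} (hxy : star x ⬝ᵥ y = 0) :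
    IsSeparableMat ((vecMulVec (pairVec x y) (star (pairVec x y))).trace •
      (1 : Matrix (Fin 2 × Fin N) (Fin 2 × Fin N) ℂ) -
        vecMulVec (pairVec x y) (star (pairVec x y))) := by
  obtain ⟨s, hs, hx⟩ := exists_star_dotProduct_self_eq_ofReal x
  obtain ⟨t, ht, hy⟩ := exists_star_dotProduct_self_eq_ofReal y
  -- The square roots of `s` and `t` are the Schmidt coefficients.
  set r := √s / √t with hr
  have hr2 : r ^ 2 = s / t := by rw [hr, div_pow, Real.sq_sqrt hs, Real.sq_sqrt ht]
  have aux {s t : ℝ} (hs : 0 ≤ s) : s / t * t ≤ s := by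
    rcases eq_or_ne t 0 with rfl | h
    · simpa
    · rw [div_mul_cancel₀ _ h]
  have hst : s / t * t ≤ s := aux hs
  have hts : t / s * s ≤ t := aux ht
  have hrr : s / t * (t / s) ≤ 1 := by
    rw [div_mul_div_comm, mul_comm t s]; exact div_self_le_one _
  have hrr0 : 0 ≤ s / t * (t / s) := by positivity
  have hoff : ((r * r⁻¹ : ℝ) : ℂ) • vecMulVec x (star y) = vecMulVec x (star y) := by
    by_cases h : r = 0
    · rw [hr, div_eq_zero_iff, Real.sqrt_eq_zero hs, Real.sqrt_eq_zero ht] at h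
      rcases h with h | h
      · rw [h, Complex.ofReal_zero, dotProduct_star_self_eq_zero] at hx
        simp [hx]
      · rw [h, Complex.ofReal_zero, dotProduct_star_self_eq_zero] at hy
        simp [hy]
    · simp [mul_inv_cancel₀ h]
  have hoff' : ((r * r⁻¹ : ℝ) : ℂ) • vecMulVec y (star x) = vecMulVec y (star x) := by
    simpa [conjTranspose_vecMulVec] using congrArg conjTranspose hoff
  have h1 := IsSeparableMat.blockMat_phase r (-((r⁻¹ : ℝ) : ℂ) • x) y
  have h2 := IsSeparableMat.blockMat_diag
    (posSemidef_sub_vecMulVec_sub_vecMulVec (n := s + t) (by positivity)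
      (k := 1 + t / s) (l := 1) (by positivity) (by positivity) hxy hx hy
      (by linarith) (by linarith))
    (posSemidef_sub_vecMulVec_sub_vecMulVec (n := s + t) (by positivity)
      (k := s / t * (t / s)) (l := 1 + s / t) (by positivity) (by positivity) hxy hx hy
      (by nlinarith) (by linarith))
  convert h1.add h2 using 1
  have e1 : ((r⁻¹ : ℝ) : ℂ) * ((r⁻¹ : ℝ) : ℂ) = ((t / s : ℝ) : ℂ) := by
    rw [← Complex.ofReal_mul, ← sq, inv_pow, hr2, inv_div]
  have e2 : (r : ℂ) ^ 2 = ((s / t : ℝ) : ℂ) := by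
    rw [← hr2, Complex.ofReal_pow]
  rw [trace_vecMulVec_pairVec, vecMulVec_pairVec, hx, hy, e2]
  ext ⟨i, a⟩ ⟨j, b⟩
  have o1 := congrFun (congrFun hoff a) b
  have o2 := congrFun (congrFun hoff' a) b
  fin_cases i <;> fin_cases j <;>
    simp [blockMat, vecMulVec_apply, one_apply] at o1 o2 e1 ⊢
  · linear_combination (-x a * starRingEnd ℂ (x b)) * e1
  · linear_combination -o1
  · linear_combination -o2
  · linear_combination (-(s / t : ℂ) * x a * starRingEnd ℂ (x b)) * e1

theorem conjA_vecMulVec (U : Matrix (Fin 2) (Fin 2) ℂ) (ψ : Fin 2 × Fin N → ℂ) :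
    conjA U (vecMulVec ψ (star ψ)) =
      vecMulVec ((U ⊗ₖ (1 : Matrix (Fin N) (Fin N) ℂ)) *ᵥ ψ)
        (star ((U ⊗ₖ (1 : Matrix (Fin N) (Fin N) ℂ)) *ᵥ ψ)) := by
  simp only [conjA, LinearMap.coe_mk, AddHom.coe_mk]
  rw [mul_vecMulVec, vecMulVec_mul, star_mulVec]

/-- For a rank one `ρ` on `ℂ² ⊗ ℂ^N`, the matrix `Tr(ρ) 𝟙 - ρ` is separable. -/
theorem isSeparableMat_trace_sub_vecMulVec (ψ : Fin 2 × Fin N → ℂ) :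
    IsSeparableMat ((vecMulVec ψ (star ψ)).trace •
      (1 : Matrix (Fin 2 × Fin N) (Fin 2 × Fin N) ℂ) - vecMulVec ψ (star ψ)) := by
  -- Schmidt decomposition: diagonalise the Gram matrix of the two components of `ψ`.
  let Ψ : Matrix (Fin 2) (Fin N) ℂ := of fun i j => ψ (i, j)
  have hG : (Ψ * Ψᴴ).IsHermitian := isHermitian_mul_conjTranspose_self Ψ
  obtain ⟨U, d, hU, hU', hd⟩ : ∃ (U : Matrix (Fin 2) (Fin 2) ℂ) (d : Fin 2 → ℂ),
      Uᴴ * U = 1 ∧ U * Uᴴ = 1 ∧ Uᴴ * (Ψ * Ψᴴ) * U = diagonal d := by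
    have h := hG.conjStarAlgAut_star_eigenvectorUnitary
    rw [Unitary.conjStarAlgAut_star_apply] at h
    exact ⟨_, _, Unitary.coe_star_mul_self hG.eigenvectorUnitary,
      Unitary.coe_mul_star_self hG.eigenvectorUnitary, h⟩
  set φ := (Uᴴ ⊗ₖ (1 : Matrix (Fin N) (Fin N) ℂ)) *ᵥ ψ with hφ
  have hφe (i : Fin 2) (j : Fin N) : φ (i, j) = (Uᴴ * Ψ) i j := by
    simp [hφ, mulVec, dotProduct, Matrix.mul_apply, Fintype.sum_prod_type, one_apply, Ψ]
  have horth : star (fun j => φ (0, j)) ⬝ᵥ (fun j => φ (1, j)) = 0 := by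
    have h : ((Uᴴ * Ψ) * (Uᴴ * Ψ)ᴴ) 1 0 = 0 := by
      have : (Uᴴ * Ψ) * (Uᴴ * Ψ)ᴴ = diagonal d := by
        rw [← hd, conjTranspose_mul, conjTranspose_conjTranspose]
        simp only [Matrix.mul_assoc]
      rw [this, diagonal_apply_ne _ (by decide)]
    rw [Matrix.mul_apply] at h
    simpa [dotProduct, hφe, mul_comm] using h
  have hback : conjA U (vecMulVec φ (star φ)) = vecMulVec ψ (star ψ) := by
    rw [conjA_vecMulVec, hφ, mulVec_mulVec, ← mul_kronecker_mul, hU']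
    simp
  have hone : conjA U (1 : Matrix (Fin 2 × Fin N) (Fin 2 × Fin N) ℂ) = 1 := by
    rw [← one_kronecker_one, conjA_kronecker]
    simp [hU']
  have htr : (vecMulVec ψ (star ψ)).trace = (vecMulVec φ (star φ)).trace := by
    have : (U ⊗ₖ (1 : Matrix (Fin N) (Fin N) ℂ))ᴴ * (U ⊗ₖ (1 : Matrix (Fin N) (Fin N) ℂ)) = 1 := by
      simp [conjTranspose_kronecker, ← mul_kronecker_mul, hU]
    rw [← hback]
    simp only [conjA, LinearMap.coe_mk, AddHom.coe_mk]
    rw [trace_mul_comm, ← Matrix.mul_assoc, this, Matrix.one_mul]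
  have := (isSeparableMat_trace_sub_of_orthogonal horth).conjA U
  rwa [pairVec_eta, map_sub, map_smul, hback, hone, ← htr] at this

theorem isSeparableMat_two_smul_add_flipA (ψ : Fin 2 × Fin N → ℂ) :
    IsSeparableMat ((2 : ℂ) • vecMulVec ψ (star ψ) + flipA (vecMulVec ψ (star ψ))) := by
  rw [← pairVec_eta ψ, vecMulVec_pairVec, flipA_blockMat]
  set x := fun j => ψ (0, j)
  set y := fun j => ψ (1, j)
  convert (IsSeparableMat.blockMat_phase 1 x y).add (IsSeparableMat.blockMat_diag
    (posSemidef_vecMulVec_self_star x) (posSemidef_vecMulVec_self_star y)) using 1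
  ext ⟨i, a⟩ ⟨j, b⟩
  fin_cases i <;> fin_cases j <;> simp [blockMat, vecMulVec_apply] <;> ring

theorem flipA_flipA_vecMulVec (ψ : Fin 2 × Fin N → ℂ) :
    flipA (flipA (vecMulVec ψ (star ψ))) = vecMulVec ψ (star ψ) := by
  rw [← pairVec_eta ψ, vecMulVec_pairVec, flipA_blockMat, flipA_blockMat, neg_neg, neg_neg]

theorem vecMulVec_add_flipA (x y : Fin N → ℂ) :
    vecMulVec (pairVec x y) (star (pairVec x y)) +
      flipA (vecMulVec (pairVec x y) (star (pairVec x y))) =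
      (1 : Matrix (Fin 2) (Fin 2) ℂ) ⊗ₖ (vecMulVec x (star x) + vecMulVec y (star y)) := by
  rw [vecMulVec_pairVec, flipA_blockMat]
  ext ⟨i, a⟩ ⟨j, b⟩
  fin_cases i <;> fin_cases j <;> simp [blockMat, vecMulVec_apply, one_apply, add_comm]

theorem kronecker_sub {R m n p q : Type*} [NonUnitalNonAssocRing R] (A : Matrix m n R)
    (B C : Matrix p q R) : A ⊗ₖ (B - C) = A ⊗ₖ B - A ⊗ₖ C := by
  ext
  simp [kroneckerMap_apply, mul_sub]

theorem isSeparableMat_trace_sub_sub_flipA (ψ : Fin 2 × Fin N → ℂ) :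
    IsSeparableMat ((vecMulVec ψ (star ψ)).trace •
      (1 : Matrix (Fin 2 × Fin N) (Fin 2 × Fin N) ℂ) -
        (vecMulVec ψ (star ψ) + flipA (vecMulVec ψ (star ψ)))) := by
  rw [← pairVec_eta ψ, vecMulVec_add_flipA, trace_vecMulVec_pairVec]
  set x := fun j => ψ (0, j)
  set y := fun j => ψ (1, j)
  have key (x : Fin N → ℂ) : ((star x ⬝ᵥ x) • (1 : Matrix (Fin N) (Fin N) ℂ) -
      vecMulVec x (star x)).PosSemidef := by
    obtain ⟨s, hs, hx⟩ := exists_star_dotProduct_self_eq_ofReal x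
    simpa [hx] using posSemidef_sub_vecMulVec_sub_vecMulVec hs zero_le_one le_rfl
      (dotProduct_zero (star x)) hx (y := 0) (t := 0) (by simp) (by simp) (by simpa)
  convert IsSeparableMat.kronecker (PosSemidef.one (n := Fin 2)) ((key x).add (key y)) using 1
  rw [sub_add_sub_comm, ← add_smul, kronecker_sub, kronecker_smul, one_kronecker_one]

theorem star_dotProduct_mulVec_star_self {V : Matrix (Fin N) (Fin N) ℂ} (hVT : Vᵀ = -V)
    (x : Fin N → ℂ) : star x ⬝ᵥ (V *ᵥ star x) = 0 := by
  have h : star x ⬝ᵥ (V *ᵥ star x) = -(star x ⬝ᵥ (V *ᵥ star x)) := by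
    conv_lhs => rw [dotProduct_mulVec, ← mulVec_transpose, hVT, neg_mulVec, neg_dotProduct,
      dotProduct_comm]
  exact self_eq_neg.mp h

theorem isSeparableMat_trace_sub_flipA_sub_flipB {V : Matrix (Fin N) (Fin N) ℂ}
    (hVU : Vᴴ * V = 1) (hVT : Vᵀ = -V) (ψ : Fin 2 × Fin N → ℂ) :
    IsSeparableMat ((vecMulVec ψ (star ψ)).trace •
      (1 : Matrix (Fin 2 × Fin N) (Fin 2 × Fin N) ℂ) -
        (vecMulVec ψ (star ψ) + flipA (vecMulVec ψ (star ψ))) -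
        flipB V (vecMulVec ψ (star ψ) + flipA (vecMulVec ψ (star ψ)))) := by
  rw [← pairVec_eta ψ, vecMulVec_add_flipA, trace_vecMulVec_pairVec, flipB_kronecker]
  set x := fun j => ψ (0, j)
  set y := fun j => ψ (1, j)
  have key (x : Fin N → ℂ) : ((star x ⬝ᵥ x) • (1 : Matrix (Fin N) (Fin N) ℂ) -
      vecMulVec x (star x) - V * (vecMulVec x (star x))ᵀ * Vᴴ).PosSemidef := by
    obtain ⟨s, hs, hx⟩ := exists_star_dotProduct_self_eq_ofReal x
    have hy : star (V *ᵥ star x) ⬝ᵥ (V *ᵥ star x) = (s : ℂ) := by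
      rw [star_mulVec, ← dotProduct_mulVec, mulVec_mulVec, hVU, one_mulVec, star_star,
        dotProduct_comm, hx]
    have hP : V * (vecMulVec x (star x))ᵀ * Vᴴ =
        vecMulVec (V *ᵥ star x) (star (V *ᵥ star x)) := by
      rw [transpose_vecMulVec, mul_vecMulVec, vecMulVec_mul, star_mulVec, star_star]
    simpa only [hx, hP, Complex.ofReal_one, one_smul] using posSemidef_sub_vecMulVec_sub_vecMulVec hs zero_le_one zero_le_one
      (star_dotProduct_mulVec_star_self hVT x) hx hy (by simp) (by simp)
  convert IsSeparableMat.kronecker (PosSemidef.one (n := Fin 2)) ((key x).add (key y)) using 1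
  rw [sub_add_sub_comm, sub_add_sub_comm, ← add_smul, ← Matrix.add_mul, ← Matrix.mul_add,
    ← transpose_add, kronecker_sub, kronecker_sub, kronecker_smul, one_kronecker_one]

theorem isSeparableMat_trace_add_add_flipA (ψ : Fin 2 × Fin N → ℂ) {m α β : ℝ} (hm : 0 ≤ m)
    (hα : -m ≤ α)
    (hβ : -m ≤ β) (hαβ : β / 2 - m ≤ α) (hβα : α / 2 - m ≤ β) :
    IsSeparableMat (((m : ℂ) * (vecMulVec ψ (star ψ)).trace) •
      (1 : Matrix (Fin 2 × Fin N) (Fin 2 × Fin N) ℂ) + (α : ℂ) • vecMulVec ψ (star ψ) +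
        (β : ℂ) • flipA (vecMulVec ψ (star ψ))) := by
  have g0 : IsSeparableMat ((vecMulVec ψ (star ψ)).trace •
      (1 : Matrix (Fin 2 × Fin N) (Fin 2 × Fin N) ℂ)) := by
    rw [trace_vecMulVec, ← one_kronecker_one, ← smul_kronecker]
    exact .kronecker (PosSemidef.one.smul (dotProduct_self_star_nonneg ψ)) .one
  have g1 := isSeparableMat_trace_sub_sub_flipA ψ
  have g2 := isSeparableMat_trace_sub_vecMulVec ψ
  have g3 := g2.flipA
  have k1 := isSeparableMat_two_smul_add_flipA ψ
  have k2 := k1.flipA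
  rw [map_sub, map_smul, flipA_one] at g3
  rw [map_add, map_smul, flipA_flipA_vecMulVec] at k2
  set ρ := vecMulVec ψ (star ψ)
  have comb {c0 c1 c2 c3 d1 d2 : ℝ} (h0 : 0 ≤ c0) (h1 : 0 ≤ c1) (h2 : 0 ≤ c2) (h3 : 0 ≤ c3)
      (h4 : 0 ≤ d1) (h5 : 0 ≤ d2) (hm : m = c0 + c1 + c2 + c3)
      (ha : α = -c1 - c2 + 2 * d1 + d2) (hb : β = -c1 - c3 + d1 + 2 * d2) :
      IsSeparableMat (((m : ℂ) * ρ.trace) • (1 : Matrix (Fin 2 × Fin N) (Fin 2 × Fin N) ℂ) +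
        (α : ℂ) • ρ + (β : ℂ) • flipA ρ) := by
    convert (((((g0.smul h0).add (g1.smul h1)).add (g2.smul h2)).add (g3.smul h3)).add
      (k1.smul h4)).add (k2.smul h5) using 1
    rw [hm, ha, hb]
    push_cast
    module
  rcases le_total 0 β with hβ0 | hβ0
  · rcases le_total α (β / 2) with h | h
    · exact comb (c0 := m + α - β / 2) (c1 := 0) (c2 := β / 2 - α) (c3 := 0) (d1 := 0)
        (d2 := β / 2) (by linarith) le_rfl (by linarith) le_rfl le_rfl (by linarith) (by ring)
        (by ring) (by ring)
    · rcases le_total β (α / 2) with h' | h'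
      · exact comb (c0 := m + β - α / 2) (c1 := 0) (c2 := 0) (c3 := α / 2 - β) (d1 := α / 2)
          (d2 := 0) (by linarith) le_rfl le_rfl (by linarith) (by linarith) le_rfl (by ring)
          (by ring) (by ring)
      · exact comb (c0 := m) (c1 := 0) (c2 := 0) (c3 := 0) (d1 := (2 * α - β) / 3)
          (d2 := (2 * β - α) / 3) hm le_rfl le_rfl le_rfl (by linarith)
          (by linarith) (by ring) (by ring) (by ring)
  · rcases le_total 0 α with hα0 | hα0
    · exact comb (c0 := m + β - α / 2) (c1 := 0) (c2 := 0) (c3 := α / 2 - β) (d1 := α / 2)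
          (d2 := 0) (by linarith) le_rfl le_rfl (by linarith) (by linarith) le_rfl (by ring)
          (by ring) (by ring)
    · rcases le_total α β with h | h
      · exact comb (c0 := m + α) (c1 := -β) (c2 := β - α) (c3 := 0) (d1 := 0) (d2 := 0)
          (by linarith) (by linarith) (by linarith) le_rfl le_rfl le_rfl (by ring) (by ring)
          (by ring)
      · exact comb (c0 := m + β) (c1 := -α) (c2 := 0) (c3 := α - β) (d1 := 0) (d2 := 0)
          (by linarith) (by linarith) le_rfl (by linarith) le_rfl le_rfl (by ring) (by ring)
          (by ring)

theorem isSeparableMat_rank_one {V : Matrix (Fin N) (Fin N) ℂ}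
    (hVU : Vᴴ * V = 1) (hVT : Vᵀ = -V) {α β γ δ a b : ℝ} (hα : -1 ≤ α) (hβ : -1 ≤ β)
    (hγ : -1 ≤ γ) (hδ : -1 ≤ δ) (ha : 0 ≤ a) (hb : 0 ≤ b) (hab : a + b ≤ 1)
    (h1 : β / 2 - a ≤ α) (h2 : α / 2 - a ≤ β) (h3 : δ / 2 - b ≤ γ) (h4 : γ / 2 - b ≤ δ)
    (ψ : Fin 2 × Fin N → ℂ) :
    IsSeparableMat ((vecMulVec ψ (star ψ)).trace •
      (1 : Matrix (Fin 2 × Fin N) (Fin 2 × Fin N) ℂ) + (α : ℂ) • vecMulVec ψ (star ψ) +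
      (β : ℂ) • flipA (vecMulVec ψ (star ψ)) + (γ : ℂ) • flipB V (vecMulVec ψ (star ψ)) +
      (δ : ℂ) • flipB V (flipA (vecMulVec ψ (star ψ)))) := by
  have comb {c m n : ℝ} (hc : 0 ≤ c) (hm0 : 0 ≤ m) (hn0 : 0 ≤ n) (hm : c + m + n = 1)
      (a1 : -m ≤ α + c) (a2 : -m ≤ β + c)
      (a3 : (β + c) / 2 - m ≤ α + c) (a4 : (α + c) / 2 - m ≤ β + c) (b1 : -n ≤ γ + c)
      (b2 : -n ≤ δ + c) (b3 : (δ + c) / 2 - n ≤ γ + c) (b4 : (γ + c) / 2 - n ≤ δ + c) :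
      IsSeparableMat ((vecMulVec ψ (star ψ)).trace •
        (1 : Matrix (Fin 2 × Fin N) (Fin 2 × Fin N) ℂ) + (α : ℂ) • vecMulVec ψ (star ψ) +
        (β : ℂ) • flipA (vecMulVec ψ (star ψ)) + (γ : ℂ) • flipB V (vecMulVec ψ (star ψ)) +
        (δ : ℂ) • flipB V (flipA (vecMulVec ψ (star ψ)))) := by
    convert (((isSeparableMat_trace_sub_flipA_sub_flipB hVU hVT ψ).smul hc).add
      (isSeparableMat_trace_add_add_flipA ψ hm0 a1 a2 a3 a4)).add
      ((isSeparableMat_trace_add_add_flipA ψ hn0 b1 b2 b3 b4).flipB V) using 1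
    simp only [map_add, map_smul, flipB_one hVU]
    obtain rfl : c = 1 - m - n := by linarith
    push_cast
    module
  rcases le_total b (1 / 2) with hb2 | hb2
  · apply comb (c := 2 * b) (m := 1 - 2 * b) (n := 0) <;> linarith
  · apply comb (c := 2 * a) (m := 0) (n := 1 - 2 * a) <;> linarith

/-- A linear map sending rank one positive matrices to separable matrices sends all positive
semidefinite matrices to separable matrices. -/
theorem Matrix.PosSemidef.isSeparableMat_map
    {ρ : Matrix (Fin M × Fin N) (Fin M × Fin N) ℂ} (hρ : ρ.PosSemidef)
    (f : Matrix (Fin M × Fin N) (Fin M × Fin N) ℂ →ₗ[ℂ] Matrix (Fin M × Fin N) (Fin M × Fin N) ℂ)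
    (hf : ∀ ψ, IsSeparableMat (f (vecMulVec ψ (star ψ)))) : IsSeparableMat (f ρ) := by
  obtain ⟨k, v, rfl⟩ := posSemidef_iff_eq_sum_vecMulVec.mp hρ
  rw [map_sum]
  exact IsSeparableMat.sum _ fun k _ => hf _

end Helpers

theorem stmt8 {N : ℕ} (hNe : Even N)
    (V : Matrix (Fin N) (Fin N) ℂ) (hVU : Vᴴ * V = 1) (hVT : Vᵀ = -V)
    (ρ : Matrix (Fin 2 × Fin N) (Fin 2 × Fin N) ℂ) (hρ : ρ.PosSemidef)
    (α β γ δ : ℝ) (hα : -1 ≤ α) (hβ : -1 ≤ β) (hγ : -1 ≤ γ) (hδ : -1 ≤ δ)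
    (hab : ∃ a b : ℝ, 0 ≤ a ∧ a ≤ 1 ∧ 0 ≤ b ∧ b ≤ 1 ∧ a + b ≤ 1 ∧
      α ≥ β / 2 - a ∧ β ≥ α / 2 - a ∧ γ ≥ δ / 2 - b ∧ δ ≥ γ / 2 - b) :
    IsSeparableMat
      (ρ.trace • (1 : Matrix (Fin 2 × Fin N) (Fin 2 × Fin N) ℂ)
        + (α : ℂ) • ρ
        + (β : ℂ) • tildeA ρ
        + (γ : ℂ) • (((1 : Matrix (Fin 2) (Fin 2) ℂ) ⊗ₖ V) * ptB ρ *
            ((1 : Matrix (Fin 2) (Fin 2) ℂ) ⊗ₖ V)ᴴ)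
        + (δ : ℂ) • ((pauli2 ⊗ₖ V) * ρᵀ * (pauli2 ⊗ₖ V)ᴴ)) := by
  obtain ⟨a, b, ha, -, hb, -, hab, h1, h2, h3, h4⟩ := hab
  have h := hρ.isSeparableMat_map
    ((traceLinearMap (Fin 2 × Fin N) ℂ ℂ).smulRight 1 + (α : ℂ) • LinearMap.id +
      (β : ℂ) • flipA + (γ : ℂ) • flipB V + (δ : ℂ) • (flipB V ∘ₗ flipA))
    (isSeparableMat_rank_one hVU hVT hα hβ hγ hδ ha hb hab h1 h2 h3 h4)
  simp only [LinearMap.add_apply, LinearMap.smul_apply, LinearMap.comp_apply, flipB_flipA,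
    LinearMap.smulRight_apply, LinearMap.id_apply, traceLinearMap_apply] at h
  simpa only [flipA_apply, flipB_apply] using h
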